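/- Let K be a triangle with diameter h_K and F an edge of K with h_F ≥ h_K/γ for some γ > 0. Then there exists C depending only on γ and the shape-regularity of K such that for every polynomial q of total degree at most k on K, (h_F/(k+1)²) ‖q‖²_{L²(∂K)} ≤ C ‖q‖²_{L²(K)}. -/

import Mathlib

open MeasureTheory Metric
open Polynomial in
lemma exists_kernel (n : ℕ) : ∃ K : ℝ[X], K.natDegree ≤ n ∧ K.eval 0 = ((n : ℝ) + 1) ^ 2 ∧
    ∀ i ≤ n, ∫ x in (0:ℝ)..1, x ^ i * K.eval x = if i = 0 then 1 else 0 := by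
  classical
  let v : ℕ → ℝ := fun j => -((j : ℝ) + 1)
  let s := Finset.range (n + 1)
  let N : ℝ[X] := ∏ i ∈ Finset.range n, (X - C ((i : ℝ) + 1))
  have hN : ∀ x : ℝ, N.eval x = ∏ i ∈ Finset.range n, (x - ((i : ℝ) + 1)) := by
    intro x; simp [N, eval_prod]
  have hv : Set.InjOn v s := by
    intro a _ b _ h
    simp only [v] at h
    have : (a : ℝ) = b := by linarith
    exact_mod_cast this
  have hdeg : N.degree < s.card := by
    have h1 : N.Monic := monic_prod_of_monic _ _ fun i _ => monic_X_sub_C _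
    have h2 : N.natDegree = n := by
      rw [natDegree_prod_of_monic _ _ fun i _ => monic_X_sub_C _]
      simp only [natDegree_X_sub_C, Finset.sum_const, Finset.card_range, smul_eq_mul, mul_one]
    rw [degree_eq_natDegree h1.ne_zero, h2]
    simp only [s, Finset.card_range]
    exact_mod_cast Nat.lt_succ_self n
  have hint := Lagrange.eq_interpolate hv hdeg
  let c : ℕ → ℝ := fun j => (-1) ^ n * ((n : ℝ) + 1) * (Lagrange.nodalWeight s v j * N.eval (v j))
  have key : ∀ i : ℕ, N.eval (i : ℝ) = (Lagrange.nodal s v).eval (i : ℝ) *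
      ∑ j ∈ s, Lagrange.nodalWeight s v j * ((i : ℝ) - v j)⁻¹ * N.eval (v j) := by
    intro i
    conv_lhs => rw [hint]
    rw [Lagrange.eval_interpolate_not_at_node]
    intro j _
    simp only [v]
    have : (0:ℝ) ≤ i := by positivity
    have : (0:ℝ) ≤ j := by positivity
    intro h; linarith
  have hnod : ∀ i : ℕ, (Lagrange.nodal s v).eval (i : ℝ) ≠ 0 := by
    intro i
    rw [Lagrange.eval_nodal, Finset.prod_ne_zero_iff]
    intro j _
    simp only [v, sub_neg_eq_add]
    positivity
  have fact : ∀ m : ℕ, ∏ j ∈ Finset.range m, ((j : ℝ) + 1) = m.factorial := by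
    intro m
    rw [← Finset.prod_range_add_one_eq_factorial]; push_cast; rfl
  have hsum : ∀ i ≤ n, ∑ j ∈ s, c j * ((i : ℝ) + j + 1)⁻¹ = if i = 0 then 1 else 0 := by
    intro i hi
    have e : ∑ j ∈ s, c j * ((i : ℝ) + j + 1)⁻¹ = (-1) ^ n * ((n : ℝ) + 1) *
        ∑ j ∈ s, Lagrange.nodalWeight s v j * ((i : ℝ) - v j)⁻¹ * N.eval (v j) := by
      rw [Finset.mul_sum]
      refine Finset.sum_congr rfl fun j _ => ?_
      simp only [c, v, sub_neg_eq_add, add_assoc]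
      ring
    have k := key i
    rw [e]
    split_ifs with h0
    · subst h0
      rw [hN, Lagrange.eval_nodal] at k
      simp only [v, Nat.cast_zero, zero_sub, s, neg_neg, fact] at k
      rw [Finset.prod_neg, fact, Nat.factorial_succ, Finset.card_range] at k
      have hf : ((n.factorial : ℕ) : ℝ) ≠ 0 := by positivity
      have k2 : (-1 : ℝ) ^ n = ((n : ℝ) + 1) * ∑ j ∈ Finset.range (n+1), Lagrange.nodalWeight s v j * ((0 : ℝ) - v j)⁻¹ * N.eval (v j) := by
        apply mul_right_cancel₀ hf
        rw [k]; push_cast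
        simp only [v, zero_sub, neg_neg, s]
        ring
      simp only [Nat.cast_zero]
      rw [mul_assoc, ← k2, ← mul_pow]; simp
    · have : N.eval (i : ℝ) = 0 := by
        rw [hN]
        apply Finset.prod_eq_zero (i := i - 1)
        · simp; omega
        · rw [Nat.cast_sub (by omega)]; simp
      rw [this] at k
      have := (mul_eq_zero.1 k.symm).resolve_left (hnod i)
      rw [this, mul_zero]
  have hK : ∀ x : ℝ, (∑ j ∈ s, C (c j) * X ^ j : ℝ[X]).eval x = ∑ j ∈ s, c j * x ^ j := by
    intro x; simp [eval_finsetSum]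
  refine ⟨∑ j ∈ s, C (c j) * X ^ j, ?_, ?_, ?_⟩
  · apply natDegree_sum_le_of_forall_le
    intro j hj
    refine (natDegree_C_mul_X_pow_le _ _).trans ?_
    simp [s] at hj; omega
  · rw [hK, Finset.sum_eq_single 0]
    · simp only [c, hN, Lagrange.nodalWeight, v, s]
      have h1 : (Finset.range (n+1)).erase 0 = (Finset.range n).image (· + 1) := by
        ext a; simp
        constructor
        · rintro ⟨h, h'⟩; exact ⟨a - 1, by omega, by omega⟩
        · rintro ⟨b, h, rfl⟩; omega
      rw [h1, Finset.prod_image (by intro a _ b _ h; simpa using h)]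
      have h2 : ∏ x ∈ Finset.range n, (-(((0:ℕ):ℝ) + 1) - -(((x + 1 : ℕ) : ℝ) + 1))⁻¹ = ((n.factorial : ℕ) : ℝ)⁻¹ := by
        rw [← fact, ← Finset.prod_inv_distrib]
        refine Finset.prod_congr rfl fun x _ => ?_
        congr 1; push_cast; ring
      have h3 : ∏ i ∈ Finset.range n, (-(((0:ℕ):ℝ) + 1) - ((i : ℝ) + 1)) = (-1) ^ n * ((n+1).factorial : ℕ) := by
        rw [← fact, Finset.prod_range_succ', ← Finset.card_range n, ← Finset.prod_const, Finset.card_range]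
        simp only [Nat.cast_zero, zero_add, mul_one]
        rw [← Finset.prod_mul_distrib]
        refine Finset.prod_congr rfl fun x _ => ?_
        push_cast; ring
      rw [h2, h3, Nat.factorial_succ]
      have hf : ((n.factorial : ℕ) : ℝ) ≠ 0 := by positivity
      have h4 : ((-1:ℝ)^n)*((-1)^n) = 1 := by rw [← mul_pow]; simp
      push_cast
      field_simp
      linear_combination h4
    · intro j _ hj; simp [hj]
    · intro h; simp [s] at h
  · intro i hi
    rw [← hsum i hi]
    simp_rw [hK, Finset.mul_sum]
    rw [intervalIntegral.integral_finsetSum]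
    · refine Finset.sum_congr rfl fun j _ => ?_
      have : ∀ x : ℝ, x ^ i * (c j * x ^ j) = c j * x ^ (i + j) := fun x => by ring
      simp_rw [this]
      rw [intervalIntegral.integral_const_mul, integral_pow]
      simp
    · intro j _
      apply Continuous.intervalIntegrable
      fun_prop

open Polynomial in
lemma poly_zero_sq_le (n : ℕ) (p : ℝ[X]) (hp : p.natDegree ≤ n) :
    p.eval 0 ^ 2 ≤ ((n : ℝ) + 1) ^ 2 * ∫ x in (0:ℝ)..1, p.eval x ^ 2 := by
  obtain ⟨K, hK, hK0, hKi⟩ := exists_kernel n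
  have rep : ∀ p : ℝ[X], p.natDegree ≤ n → ∫ x in (0:ℝ)..1, p.eval x * K.eval x = p.eval 0 := by
    intro p hp
    have : ∀ x, p.eval x = ∑ i ∈ Finset.range (n+1), p.coeff i * x ^ i :=
      fun x => eval_eq_sum_range' (by omega) x
    simp_rw [this, Finset.sum_mul]
    rw [intervalIntegral.integral_finsetSum]
    · have : ∀ i ∈ Finset.range (n+1), ∫ x in (0:ℝ)..1, p.coeff i * x ^ i * K.eval x
          = p.coeff i * 0 ^ i := by
        intro i hi
        simp_rw [mul_assoc]
        rw [intervalIntegral.integral_const_mul, hKi i (by simp at hi; omega)]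
        congr 1
        split_ifs with h <;> simp [h]
      exact Finset.sum_congr rfl this
    · intro j _
      apply Continuous.intervalIntegrable
      fun_prop
  have hn : (0:ℝ) < ((n : ℝ) + 1) ^ 2 := by positivity
  set a := p.eval 0 / ((n : ℝ) + 1) ^ 2 with ha
  have h0 : 0 ≤ ∫ x in (0:ℝ)..1, (p.eval x - a * K.eval x) ^ 2 :=
    intervalIntegral.integral_nonneg (by norm_num) fun x _ => sq_nonneg _
  have h1 : ∫ x in (0:ℝ)..1, (p.eval x - a * K.eval x) ^ 2 =
      (∫ x in (0:ℝ)..1, p.eval x ^ 2) - 2 * a * p.eval 0 + a ^ 2 * ((n : ℝ) + 1) ^ 2 := by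
    rw [← rep p hp, ← hK0, ← rep K hK, ← intervalIntegral.integral_const_mul,
      ← intervalIntegral.integral_const_mul, ← intervalIntegral.integral_sub,
      ← intervalIntegral.integral_add]
    · congr 1; ext x; ring
    all_goals
      apply Continuous.intervalIntegrable
      fun_prop
  rw [h1] at h0
  have h2 : p.eval 0 = a * ((n : ℝ) + 1) ^ 2 := by rw [ha]; field_simp
  rw [h2] at h0 ⊢
  nlinarith

open Polynomial in
lemma poly_zero_sq_le_half (n : ℕ) (p : ℝ[X]) (hp : p.natDegree ≤ n) :
    p.eval 0 ^ 2 ≤ 2 * ((n : ℝ) + 1) ^ 2 * ∫ x in (0:ℝ)..(1/2), p.eval x ^ 2 := by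
  have h := poly_zero_sq_le n (p.comp (C (1/2) * X)) (by
    refine natDegree_comp_le.trans ?_
    have : (C (1/2 : ℝ) * X).natDegree ≤ 1 := by simp
    nlinarith)
  simp only [eval_comp, eval_mul, eval_C, eval_X, mul_zero] at h
  rw [intervalIntegral.integral_comp_mul_left (fun x => p.eval x ^ 2) (by norm_num)] at h
  simp at h ⊢
  linarith

abbrev E2 := EuclideanSpace ℝ (Fin 2)

lemma indep_of_affine {A B P : E2} (h : AffineIndependent ℝ ![A, B, P]) (a b : ℝ)
    (hab : a • (B - A) + b • (P - A) = 0) : a = 0 ∧ b = 0 := by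
  rw [affineIndependent_iff] at h
  have := h Finset.univ ![-a-b, a, b] (by simp [Fin.sum_univ_three]; ring) (by
    simp only [Fin.sum_univ_three, Matrix.cons_val_zero, Matrix.cons_val_one, Matrix.cons_val]
    rw [← hab]; module)
  exact ⟨by simpa using this 1 (by simp), by simpa using this 2 (by simp)⟩

lemma map_param (A v w : E2) (hind : ∀ a b : ℝ, a • v + b • w = 0 → a = 0 ∧ b = 0) :
    ∃ D : ℝ, 0 < D ∧ (volume : Measure E2) = ENNReal.ofReal D •
      Measure.map (fun p : ℝ × ℝ => A + (p.1 • v + p.2 • w)) volume := by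
  let L : E2 →ₗ[ℝ] E2 :=
    { toFun := fun x => x 0 • v + x 1 • w
      map_add' := by intro x y; simp only [PiLp.add_apply]; module
      map_smul' := by intro c x; simp only [PiLp.smul_apply, smul_eq_mul, RingHom.id_apply]; module }
  have hdet : LinearMap.det L ≠ 0 := by
    intro h0
    have := LinearMap.bot_lt_ker_of_det_eq_zero h0
    obtain ⟨x, hx, hx0⟩ := (Submodule.ne_bot_iff _).1 this.ne'
    obtain ⟨h1, h2⟩ := hind _ _ (LinearMap.mem_ker.1 hx)
    apply hx0
    ext i; fin_cases i
    · exact h1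
    · exact h2
  have hL : Measurable L := L.continuous_of_finiteDimensional.measurable
  have h1 := Measure.map_linearMap_addHaar_eq_smul_addHaar (volume : Measure E2) hdet
  have g1 : MeasurePreserving (fun p : ℝ × ℝ => (WithLp.toLp 2 (MeasurableEquiv.finTwoArrow.symm p) : E2)) :=
    (PiLp.volume_preserving_toLp (Fin 2)).comp (volume_preserving_finTwoArrow ℝ).symm
  have g2 : MeasurePreserving (fun x : E2 => A + x) := measurePreserving_add_left volume A
  have h2 : Measure.map (fun p : ℝ × ℝ => A + (p.1 • v + p.2 • w)) volume
      = ENNReal.ofReal |(LinearMap.det L)⁻¹| • (volume : Measure E2) := by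
    have : (fun p : ℝ × ℝ => A + (p.1 • v + p.2 • w)) = (fun x : E2 => A + x) ∘ L ∘
      (fun p : ℝ × ℝ => (WithLp.toLp 2 (MeasurableEquiv.finTwoArrow.symm p) : E2)) := by
      ext p; simp [L]
    rw [this, ← Measure.map_map g2.measurable (hL.comp g1.measurable), ← Measure.map_map hL g1.measurable,
      g1.map_eq, h1, Measure.map_smul, g2.map_eq]
  refine ⟨|LinearMap.det L|, by positivity, ?_⟩
  rw [h2, smul_smul, ← ENNReal.ofReal_mul (by positivity), abs_inv, mul_inv_cancel₀ (by positivity)]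
  simp

lemma half_edge (A B P : E2) (hind : ∀ a b : ℝ, a • (B - A) + b • (P - A) = 0 → a = 0 ∧ b = 0)
    (K : Set E2) (hK : K = convexHull ℝ {A, B, P}) (x : E2) (r : ℝ) (hr : 0 < r)
    (hball : Metric.ball x r ⊆ K) (F : E2 → ℝ) (hF : Continuous F) (hF0 : ∀ y, 0 ≤ F y)
    (M : ℝ) (hM0 : 0 ≤ M)
    (hM : ∀ a w : E2, F a ≤ M * ∫ t in (0:ℝ)..(1/2), F (a + t • w)) :
    r ^ 2 * ∫ s in (0:ℝ)..(1/2), F (A + s • (B - A)) ≤ M * ∫ y in K, F y := by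
  obtain ⟨D, hD, hvol⟩ := map_param A (B - A) (P - A) hind
  set φ : ℝ × ℝ → E2 := fun p => A + (p.1 • (B - A) + p.2 • (P - A)) with hφ
  have hφc : Continuous φ := by fun_prop
  have hcomp : IsCompact K := by
    rw [hK]; exact (Set.toFinite _).isCompact_convexHull (𝕜 := ℝ)
  have hKm : MeasurableSet K := hcomp.measurableSet
  have hA : A ∈ K := by rw [hK]; exact subset_convexHull ℝ _ (by simp)
  have hB : B ∈ K := by rw [hK]; exact subset_convexHull ℝ _ (by simp)
  have hP : P ∈ K := by rw [hK]; exact subset_convexHull ℝ _ (by simp)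
  have hconv : Convex ℝ K := by rw [hK]; exact convex_convexHull ℝ _
  -- preimage in the unit square
  have hpre : φ ⁻¹' K ⊆ Set.Icc 0 1 ×ˢ Set.Icc 0 1 := by
    have hsub : K ⊆ φ '' (Set.Icc 0 1 ×ˢ Set.Icc 0 1) := by
      rw [hK]
      apply convexHull_min
      · intro y hy
        simp only [Set.mem_insert_iff, Set.mem_singleton_iff] at hy
        rcases hy with rfl | rfl | rfl
        · exact ⟨(0, 0), by simp, by simp [hφ]⟩
        · exact ⟨(1, 0), by simp, by simp [hφ]⟩
        · exact ⟨(0, 1), by simp, by simp [hφ]⟩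
      · rintro _ ⟨p, hp, rfl⟩ _ ⟨p', hp', rfl⟩ a b ha hb hab
        refine ⟨a • p + b • p', ((convex_Icc (0:ℝ) 1).prod (convex_Icc (0:ℝ) 1)) hp hp' ha hb hab, ?_⟩
        simp only [hφ, Prod.fst_add, Prod.snd_add, Prod.smul_fst, Prod.smul_snd, smul_eq_mul]
        obtain rfl : b = 1 - a := by linarith
        module
    rintro p hp
    obtain ⟨p', hp', he⟩ := hsub hp
    have := hind (p.1 - p'.1) (p.2 - p'.2) (by
      have h2 : φ p - φ p' = 0 := by rw [he, sub_self]
      rw [← h2]; simp only [hφ]; module)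
    have : p = p' := Prod.ext (by linarith [this.1]) (by linarith [this.2])
    rwa [this]
  have hsq : Set.Icc (0:ℝ) (1/2) ×ˢ Set.Icc (0:ℝ) (1/2) ⊆ φ ⁻¹' K := by
    rintro ⟨s, t⟩ ⟨⟨hs0, hs1⟩, ⟨ht0, ht1⟩⟩
    simp only at hs0 hs1 ht0 ht1
    have := hconv.sum_mem (t := (Finset.univ : Finset (Fin 3))) (w := ![1 - s - t, s, t]) (z := ![A, B, P])
      (by intro i _; fin_cases i <;> simp <;> linarith) (by simp [Fin.sum_univ_three]; ring)
      (by intro i _; fin_cases i <;> simp [hA, hB, hP])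
    simp only [Fin.sum_univ_three, Matrix.cons_val_zero, Matrix.cons_val_one, Matrix.cons_val] at this
    show A + (s • (B - A) + t • (P - A)) ∈ K
    convert this using 1
    module
  -- area
  have harea : r ^ 2 ≤ D := by
    have h1 : volume (Metric.ball x r) ≤ ENNReal.ofReal D := by
      calc volume (Metric.ball x r) ≤ volume K := measure_mono hball
        _ = ENNReal.ofReal D * volume (φ ⁻¹' K) := by
          rw [hvol, Measure.smul_apply, Measure.map_apply hφc.measurable hKm, smul_eq_mul]
        _ ≤ ENNReal.ofReal D * volume (Set.Icc (0:ℝ) 1 ×ˢ Set.Icc (0:ℝ) 1) := by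
          gcongr
        _ = ENNReal.ofReal D := by
          rw [Measure.volume_eq_prod, Measure.prod_prod]; simp
    rw [EuclideanSpace.volume_ball_fin_two, ← ENNReal.ofReal_pow hr.le,
      ← ENNReal.ofReal_mul (by positivity), ENNReal.ofReal_le_ofReal_iff hD.le] at h1
    nlinarith [Real.pi_gt_three, sq_nonneg r]
  have hint : ∫ y in K, F y = D * ∫ p in φ ⁻¹' K, F (φ p) := by
    rw [← setIntegral_map hKm hF.aestronglyMeasurable hφc.aemeasurable]
    conv_lhs => rw [hvol]
    rw [Measure.restrict_smul, integral_smul_measure, ENNReal.toReal_ofReal hD.le, smul_eq_mul]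
  have hFφ : Continuous fun p => F (φ p) := hF.comp hφc
  have hintsq : IntegrableOn (fun p => F (φ p)) (Set.Icc (0:ℝ) 1 ×ˢ Set.Icc (0:ℝ) 1) :=
    hFφ.continuousOn.integrableOn_compact (isCompact_Icc.prod isCompact_Icc)
  have hge : ∫ p in Set.Icc (0:ℝ) (1/2) ×ˢ Set.Icc (0:ℝ) (1/2), F (φ p) ≤ ∫ p in φ ⁻¹' K, F (φ p) :=
    setIntegral_mono_set (hintsq.mono_set hpre) (Filter.Eventually.of_forall fun p => hF0 _)
      (Filter.Eventually.of_forall hsq)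
  have hiter : ∫ p in Set.Icc (0:ℝ) (1/2) ×ˢ Set.Icc (0:ℝ) (1/2), F (φ p) =
      ∫ s in (0:ℝ)..(1/2), ∫ t in (0:ℝ)..(1/2), F (φ (s, t)) := by
    rw [Measure.volume_eq_prod, setIntegral_prod]
    · rw [intervalIntegral.integral_of_le (by norm_num), integral_Icc_eq_integral_Ioc]
      congr 1; ext s
      rw [intervalIntegral.integral_of_le (by norm_num), integral_Icc_eq_integral_Ioc]
    · exact hintsq.mono_set (hsq.trans hpre)
  have hline : ∫ s in (0:ℝ)..(1/2), F (A + s • (B - A)) ≤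
      M * ∫ s in (0:ℝ)..(1/2), ∫ t in (0:ℝ)..(1/2), F (φ (s, t)) := by
    rw [← intervalIntegral.integral_const_mul]
    apply intervalIntegral.integral_mono_on (by norm_num)
    · apply Continuous.intervalIntegrable; fun_prop
    · apply Continuous.intervalIntegrable
      apply continuous_const.mul
      apply intervalIntegral.continuous_parametric_intervalIntegral_of_continuous'
      exact hFφ
    · intro s _
      have := hM (A + s • (B - A)) (P - A)
      simpa only [hφ, add_assoc] using this
  have hI0 : 0 ≤ ∫ s in (0:ℝ)..(1/2), F (A + s • (B - A)) :=
    intervalIntegral.integral_nonneg (by norm_num) fun s _ => hF0 _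
  calc r ^ 2 * ∫ s in (0:ℝ)..(1/2), F (A + s • (B - A))
      ≤ D * ∫ s in (0:ℝ)..(1/2), F (A + s • (B - A)) := by gcongr
    _ ≤ D * (M * ∫ p in φ ⁻¹' K, F (φ p)) := by
      gcongr
      refine hline.trans ?_
      rw [← hiter]
      gcongr
    _ = M * ∫ y in K, F y := by rw [hint]; ring

lemma segment_measure (A B : E2) :
    (μH[1] : Measure E2).restrict (segment ℝ A B) =
      nndist A B • Measure.map (fun s : ℝ => A + s • (B - A)) (volume.restrict (Set.Icc 0 1)) := by
  have hc : Continuous (fun s : ℝ => A + s • (B - A)) := by fun_prop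
  ext T hT
  have : T ∩ segment ℝ A B = AffineMap.lineMap A B '' ((fun s : ℝ => A + s • (B - A)) ⁻¹' T ∩ Set.Icc 0 1) := by
    rw [segment_eq_image']
    ext y
    constructor
    · rintro ⟨hy, s, hs, rfl⟩
      exact ⟨s, ⟨hy, hs⟩, by simp [AffineMap.lineMap_apply, add_comm]⟩
    · rintro ⟨s, ⟨hy, hs⟩, rfl⟩
      have e : (AffineMap.lineMap A B) s = A + s • (B - A) := by simp [AffineMap.lineMap_apply, add_comm]
      rw [e]
      exact ⟨hy, s, hs, rfl⟩
  rw [Measure.restrict_apply hT, this, hausdorffMeasure_lineMap_image, hausdorffMeasure_real,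
    Measure.smul_apply, Measure.map_apply hc.measurable hT,
    Measure.restrict_apply (hc.measurable hT)]

lemma segment_integrable (A B : E2) (F : E2 → ℝ) (hF : Continuous F) :
    Integrable F ((μH[1] : Measure E2).restrict (segment ℝ A B)) := by
  have hc : Continuous (fun s : ℝ => A + s • (B - A)) := by fun_prop
  rw [segment_measure A B]
  apply Integrable.smul_measure_nnreal
  rw [integrable_map_measure hF.aestronglyMeasurable hc.aemeasurable]
  exact (hF.comp hc).continuousOn.integrableOn_compact isCompact_Icc

lemma segment_integral (A B : E2) (F : E2 → ℝ) (hF : Continuous F) :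
    ∫ y in segment ℝ A B, F y ∂μH[1] = dist A B *
      ((∫ s in (0:ℝ)..(1/2), F (A + s • (B - A))) + ∫ s in (0:ℝ)..(1/2), F (B + s • (A - B))) := by
  have hc : Continuous (fun s : ℝ => A + s • (B - A)) := by fun_prop
  have h2 : ∫ s in (0:ℝ)..(1/2), F (B + s • (A - B)) = ∫ s in (1/2:ℝ)..1, F (A + s • (B - A)) := by
    have := intervalIntegral.integral_comp_sub_left (a := 0) (b := 1/2) (fun s : ℝ => F (A + s • (B - A))) 1
    norm_num at this
    norm_num
    rw [← this]
    congr 1; ext s; congr 1; module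
  rw [segment_measure A B, integral_smul_nnreal_measure, integral_map hc.aemeasurable hF.aestronglyMeasurable,
    integral_Icc_eq_integral_Ioc, ← intervalIntegral.integral_of_le (by norm_num), h2,
    intervalIntegral.integral_add_adjacent_intervals]
  · rfl
  all_goals
    apply Continuous.intervalIntegrable; fun_prop

lemma frontier_subset (A B P : E2) (h : AffineIndependent ℝ ![A, B, P]) :
    frontier (convexHull ℝ {A, B, P}) ⊆ segment ℝ A B ∪ segment ℝ B P ∪ segment ℝ P A := by
  let b : AffineBasis (Fin 3) ℝ E2 := ⟨![A, B, P], h, by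
    rw [h.affineSpan_eq_top_iff_card_eq_finrank_add_one]; simp⟩
  have hr : Set.range b = {A, B, P} := by
    show Set.range ![A, B, P] = _
    rw [Matrix.range_cons, Matrix.range_cons, Matrix.range_cons, Matrix.range_empty, Set.union_empty]
    rfl
  intro x hx
  have hcl : IsClosed (convexHull ℝ {A, B, P}) :=
    ((Set.toFinite {A, B, P}).isCompact_convexHull (𝕜 := ℝ)).isClosed
  rw [hcl.frontier_eq, ← hr, b.interior_convexHull, b.convexHull_eq_nonneg_coord] at hx
  obtain ⟨h1, h2⟩ := hx
  simp only [Set.mem_ofPred_eq, not_forall, not_lt] at h1 h2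
  obtain ⟨i, hi⟩ := h2
  have hi0 := le_antisymm hi (h1 i)
  have hs := b.linear_combination_coord_eq_self x
  have hs1 := b.sum_coord_apply_eq_one x
  rw [Fin.sum_univ_three] at hs hs1
  change _ • A + _ • B + _ • P = x at hs
  fin_cases i
  · left; right
    refine ⟨_, _, h1 1, h1 2, ?_, ?_⟩
    · simp at hi0; linarith
    · simp at hi0; rw [hi0] at hs; simpa using hs
  · right
    refine ⟨_, _, h1 2, h1 0, ?_, ?_⟩
    · simp at hi0; linarith
    · simp at hi0; rw [hi0] at hs; rw [add_comm]; simpa using hs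
  · left; left
    refine ⟨_, _, h1 0, h1 1, ?_, ?_⟩
    · simp at hi0; linarith
    · simp at hi0; rw [hi0] at hs; simpa using hs

lemma eval_poly (k : ℕ) (q : MvPolynomial (Fin 2) ℝ) (hq : q.totalDegree ≤ k) (a w : E2)
    (key : ∀ p : Polynomial ℝ, p.natDegree ≤ k →
      p.eval 0 ^ 2 ≤ 2 * ((k : ℝ) + 1) ^ 2 * ∫ x in (0:ℝ)..(1/2), p.eval x ^ 2) :
    (MvPolynomial.eval (fun i => a i) q) ^ 2 ≤ 2 * ((k : ℝ) + 1) ^ 2 *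
      ∫ t in (0:ℝ)..(1/2), (MvPolynomial.eval (fun i => (a + t • w) i) q) ^ 2 := by
  let f : Fin 2 → Polynomial ℝ := fun i => Polynomial.C (w i) * Polynomial.X + Polynomial.C (a i)
  have hd : (MvPolynomial.aeval f q).natDegree ≤ k := by
    have := MvPolynomial.aeval_natDegree_le (n := 1) q hq f (fun i => Polynomial.natDegree_linear_le)
    simpa using this
  have he : ∀ t : ℝ, (MvPolynomial.aeval f q).eval t = MvPolynomial.eval (fun i => (a + t • w) i) q := by
    intro t
    rw [← Polynomial.coe_evalRingHom, MvPolynomial.aeval_def, MvPolynomial.eval₂_eq_eval_map,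
      ← MvPolynomial.eval₂_eq_eval_map, MvPolynomial.hom_eval₂]
    have e1 : (Polynomial.evalRingHom t).comp (algebraMap ℝ (Polynomial ℝ)) = RingHom.id ℝ := by
      ext; simp
    rw [e1]
    have e2 : (fun i => (a + t • w) i) = (Polynomial.evalRingHom t : Polynomial ℝ → ℝ) ∘ f := by
      ext i; simp [f]; ring
    rw [e2]
    rfl
  have := key _ hd
  simp only [he] at this
  simpa using this

/-- hp discrete trace inequality on a triangle K with edge F: under local quasi-uniformity
h_F ≥ h_K/γ and shape regularity (K contains a ball of radius ≥ h_K/θ), there is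
C = C(γ, θ) such that for every polynomial q of total degree ≤ k,
(h_F/(k+1)²)‖q‖²_{L²(∂K)} ≤ C ‖q‖²_{L²(K)}. -/
theorem stmt_17 (γ θ : ℝ) (hγ : 0 < γ) (hθ : 0 < θ) :
    ∃ C : ℝ, 0 < C ∧
      ∀ A B P : EuclideanSpace ℝ (Fin 2),
        AffineIndependent ℝ ![A, B, P] →
        dist A B ≥ Metric.diam (convexHull ℝ {A, B, P}) / γ →
        (∃ (x : EuclideanSpace ℝ (Fin 2)) (r : ℝ),
          Metric.diam (convexHull ℝ {A, B, P}) ≤ θ * r ∧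
          Metric.ball x r ⊆ convexHull ℝ {A, B, P}) →
        ∀ (k : ℕ) (q : MvPolynomial (Fin 2) ℝ), q.totalDegree ≤ k →
          (dist A B / ((k : ℝ) + 1) ^ 2) *
              ∫ x in frontier (convexHull ℝ {A, B, P}),
                (MvPolynomial.eval (fun i => x i) q) ^ 2 ∂(μH[1]) ≤
            C * ∫ x in convexHull ℝ {A, B, P},
                (MvPolynomial.eval (fun i => x i) q) ^ 2 := by
  refine ⟨12 * θ ^ 2, by positivity, ?_⟩
  rintro A B P hAff - ⟨x, r, hdiam, hball⟩ k q hq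
  have hind := indep_of_affine hAff
  set K := convexHull ℝ {A, B, P} with hK
  have hcomp : IsCompact K := (Set.toFinite _).isCompact_convexHull (𝕜 := ℝ)
  have hA : A ∈ K := subset_convexHull ℝ _ (by simp)
  have hB : B ∈ K := subset_convexHull ℝ _ (by simp)
  have hP : P ∈ K := subset_convexHull ℝ _ (by simp)
  set h := Metric.diam K with hh
  have d1 : dist A B ≤ h := dist_le_diam_of_mem hcomp.isBounded hA hB
  have d2 : dist B P ≤ h := dist_le_diam_of_mem hcomp.isBounded hB hP
  have d3 : dist P A ≤ h := dist_le_diam_of_mem hcomp.isBounded hP hA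
  have hAB : A ≠ B := by
    rintro rfl
    have := hind 1 0 (by simp)
    norm_num at this
  have hpos : 0 < h := (dist_pos.2 hAB).trans_le d1
  have hr : 0 < r := by
    by_contra hcon
    nlinarith
  set F : E2 → ℝ := fun y => (MvPolynomial.eval (fun i => y i) q) ^ 2 with hFdef
  have hF : Continuous F := by
    have : Continuous fun y : E2 => MvPolynomial.eval (fun i => y i) q :=
      (MvPolynomial.continuous_eval q).comp (by fun_prop)
    exact this.pow 2
  have hF0 : ∀ y, 0 ≤ F y := fun y => sq_nonneg _
  set M : ℝ := 2 * ((k : ℝ) + 1) ^ 2 with hM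
  have hM0 : 0 ≤ M := by positivity
  have hMF : ∀ a w : E2, F a ≤ M * ∫ t in (0:ℝ)..(1/2), F (a + t • w) := fun a w =>
    eval_poly k q hq a w (poly_zero_sq_le_half k)
  have hhalf : ∀ A' B' P' : E2, (∀ a b : ℝ, a • (B' - A') + b • (P' - A') = 0 → a = 0 ∧ b = 0) →
      ({A, B, P} : Set E2) = {A', B', P'} →
      r ^ 2 * ∫ s in (0:ℝ)..(1/2), F (A' + s • (B' - A')) ≤ M * ∫ y in K, F y := by
    intro A' B' P' hi he
    exact half_edge A' B' P' hi K (by rw [hK, he]) x r hr hball F hF hF0 M hM0 hMF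
  set I := ∫ y in K, F y with hI
  have hI0 : 0 ≤ I := integral_nonneg hF0
  have e1 := hhalf A B P hind rfl
  have e2 := hhalf B A P (fun a b hab => by
    have := hind (-a - b) b (by rw [← hab]; module)
    exact ⟨by linarith [this.1, this.2], this.2⟩) (by ext; simp; tauto)
  have e3 := hhalf B P A (fun a b hab => by
    have := hind (-a - b) a (by rw [← hab]; module)
    exact ⟨this.2, by linarith [this.1, this.2]⟩) (by ext; simp; tauto)
  have e4 := hhalf P B A (fun a b hab => by
    have := hind a (-a - b) (by rw [← hab]; module)
    exact ⟨this.1, by linarith [this.1, this.2]⟩) (by ext; simp; tauto)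
  have e5 := hhalf P A B (fun a b hab => by
    have := hind b (-a - b) (by rw [← hab]; module)
    exact ⟨by linarith [this.1, this.2], this.1⟩) (by ext; simp; tauto)
  have e6 := hhalf A P B (fun a b hab => by
    have := hind b a (by rw [← hab]; module)
    exact ⟨this.2, this.1⟩) (by ext; simp; tauto)
  have hseg : ∀ A' B' : E2, dist A' B' ≤ h →
      r ^ 2 * (∫ s in (0:ℝ)..(1/2), F (A' + s • (B' - A'))) ≤ M * I →
      r ^ 2 * (∫ s in (0:ℝ)..(1/2), F (B' + s • (A' - B'))) ≤ M * I →
      r ^ 2 * ∫ y in segment ℝ A' B', F y ∂μH[1] ≤ h * (2 * (M * I)) := by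
    intro A' B' hd h1 h2
    rw [segment_integral A' B' F hF]
    calc _ = dist A' B' * (r ^ 2 * (∫ s in (0:ℝ)..(1/2), F (A' + s • (B' - A'))) +
          r ^ 2 * (∫ s in (0:ℝ)..(1/2), F (B' + s • (A' - B')))) := by ring
      _ ≤ dist A' B' * (2 * (M * I)) := by gcongr; linarith
      _ ≤ _ := by gcongr
  have s1 := hseg A B d1 e1 e2
  have s2 := hseg B P d2 e3 e4
  have s3 := hseg P A d3 e5 e6
  have hfr : ∫ y in frontier K, F y ∂μH[1] ≤ (∫ y in segment ℝ A B, F y ∂μH[1]) +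
      (∫ y in segment ℝ B P, F y ∂μH[1]) + ∫ y in segment ℝ P A, F y ∂μH[1] := by
    have i1 := segment_integrable A B F hF
    have i2 := segment_integrable B P F hF
    have i3 := segment_integrable P A F hF
    rw [← integral_add_measure i1 i2, ← integral_add_measure (i1.add_measure i2) i3]
    apply integral_mono_measure _ (Filter.Eventually.of_forall hF0) ((i1.add_measure i2).add_measure i3)
    refine (Measure.restrict_mono (frontier_subset A B P hAff) le_rfl).trans ?_
    refine (Measure.restrict_union_le _ _).trans ?_
    gcongr
    exact Measure.restrict_union_le _ _
  set J := ∫ y in frontier K, F y ∂μH[1] with hJ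
  have hJ0 : 0 ≤ J := integral_nonneg hF0
  have hk : (0:ℝ) < ((k : ℝ) + 1) ^ 2 := by positivity
  have hJr : r ^ 2 * J ≤ h * (12 * (((k : ℝ) + 1) ^ 2 * I)) := by
    have := mul_le_mul_of_nonneg_left hfr (sq_nonneg r)
    rw [hM] at s1 s2 s3
    linarith
  have hsq : h * h ≤ θ ^ 2 * r ^ 2 := by
    nlinarith [mul_le_mul hdiam hdiam hpos.le (hpos.le.trans hdiam)]
  have hr2 : 0 < r ^ 2 := by positivity
  rw [div_mul_eq_mul_div, div_le_iff₀ hk]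
  have t1 : dist A B * J ≤ h * J := by gcongr
  refine t1.trans ?_
  refine le_of_mul_le_mul_left ?_ hr2
  calc r ^ 2 * (h * J) = h * (r ^ 2 * J) := by ring
    _ ≤ h * (h * (12 * (((k : ℝ) + 1) ^ 2 * I))) := by gcongr
    _ = (h * h) * (12 * (((k : ℝ) + 1) ^ 2 * I)) := by ring
    _ ≤ (θ ^ 2 * r ^ 2) * (12 * (((k : ℝ) + 1) ^ 2 * I)) := by gcongr
    _ = _ := by ring
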